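/- arXiv:2510.17648 — 2 statements merged into one kernel-verified Lean document; each statement's English description precedes it below -/
import Mathlib

section
/- Let μ and ν be Borel probability measures on ℝ, and suppose for some ε, δ > 0 that μ(A) ≤ ν(A^δ) + ε for every Borel set A ⊆ ℝ, where A^δ is the closed δ-enlargement of A. Then for any random variable V with law μ (on a rich enough probability space), there exists a random variable W with law ν such that P(|V − W| > δ) ≤ ε. -/
open MeasureTheory ProbabilityTheory

noncomputable def dfc (μ ν : Measure ℝ) (δ : ℝ) (S : Set ℝ) : ℝ :=
  sSup {r | ∃ A : Set ℝ, A ⊆ S ∧ MeasurableSet A ∧ r = μ.real A - ν.real (Metric.cthickening δ A)}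

section
variable {μ ν : Measure ℝ} [IsProbabilityMeasure μ] [IsFiniteMeasure ν] {δ ε : ℝ}

lemma dfc_bdd (S : Set ℝ) : BddAbove {r | ∃ A : Set ℝ, A ⊆ S ∧ MeasurableSet A ∧
    r = μ.real A - ν.real (Metric.cthickening δ A)} := by
  refine ⟨1, ?_⟩
  rintro r ⟨A, -, -, rfl⟩
  have h1 : μ.real A ≤ 1 := measureReal_le_one
  have h2 : 0 ≤ ν.real (Metric.cthickening δ A) := measureReal_nonneg
  linarith

lemma le_dfc {A S : Set ℝ} (h : A ⊆ S) (hA : MeasurableSet A) :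
    μ.real A - ν.real (Metric.cthickening δ A) ≤ dfc μ ν δ S :=
  le_csSup (dfc_bdd S) ⟨A, h, hA, rfl⟩

lemma dfc_le {S : Set ℝ} {c : ℝ} (h : ∀ A ⊆ S, MeasurableSet A →
    μ.real A - ν.real (Metric.cthickening δ A) ≤ c) : dfc μ ν δ S ≤ c := by
  refine csSup_le ⟨_, ∅, by simp, MeasurableSet.empty, rfl⟩ ?_
  rintro r ⟨A, h1, h2, rfl⟩
  exact h A h1 h2

lemma dfc_nonneg (S : Set ℝ) : 0 ≤ dfc μ ν δ S := by
  have := le_dfc (μ := μ) (ν := ν) (δ := δ) (Set.empty_subset S) MeasurableSet.empty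
  simpa using this

lemma dfc_mono {S T : Set ℝ} (h : S ⊆ T) : dfc μ ν δ S ≤ dfc μ ν δ T :=
  dfc_le fun _ hA hm => le_dfc (hA.trans h) hm

lemma dfc_le_add {S T : Set ℝ} (hS : MeasurableSet S) :
    dfc μ ν δ (S ∪ T) ≤ dfc μ ν δ S + μ.real T := by
  refine dfc_le fun A hA hm => ?_
  have h1 := le_dfc (μ := μ) (ν := ν) (δ := δ) (Set.inter_subset_right : A ∩ S ⊆ S) (hm.inter hS)
  have h2 : ν.real (Metric.cthickening δ (A ∩ S)) ≤ ν.real (Metric.cthickening δ A) :=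
    measureReal_mono (Metric.cthickening_subset_of_subset _ Set.inter_subset_left)
  have h3 : μ.real A ≤ μ.real (A ∩ S) + μ.real T := by
    refine (measureReal_mono (μ := μ) (s₂ := (A ∩ S) ∪ T) ?_).trans (measureReal_union_le _ _)
    intro x hx
    rcases hA hx with h | h
    · exact Or.inl ⟨hx, h⟩
    · exact Or.inr h
  linarith

lemma dfc_super (S T : Set ℝ) :
    dfc μ ν δ S + dfc μ ν δ T ≤ dfc μ ν δ (S ∪ T) + dfc μ ν δ (S ∩ T) := by
  suffices h : dfc μ ν δ S ≤ dfc μ ν δ (S ∪ T) + dfc μ ν δ (S ∩ T) - dfc μ ν δ T by linarith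
  refine dfc_le fun A hA hAm => ?_
  suffices h : dfc μ ν δ T ≤ dfc μ ν δ (S ∪ T) + dfc μ ν δ (S ∩ T) -
    (μ.real A - ν.real (Metric.cthickening δ A)) by linarith
  refine dfc_le fun B hB hBm => ?_
  have h1 := le_dfc (μ := μ) (ν := ν) (δ := δ) (Set.union_subset_union hA hB) (hAm.union hBm)
  have h2 := le_dfc (μ := μ) (ν := ν) (δ := δ) (Set.inter_subset_inter hA hB) (hAm.inter hBm)
  have h3 := measureReal_union_add_inter (μ := μ) (s := A) (t := B) hBm
  have h4 := measureReal_union_add_inter (μ := ν) (s := Metric.cthickening δ A)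
    (t := Metric.cthickening δ B) Metric.isClosed_cthickening.measurableSet
  rw [← Metric.cthickening_union] at h4
  have h5 : ν.real (Metric.cthickening δ (A ∩ B)) ≤
      ν.real (Metric.cthickening δ A ∩ Metric.cthickening δ B) :=
    measureReal_mono (Set.subset_inter
      (Metric.cthickening_subset_of_subset _ Set.inter_subset_left)
      (Metric.cthickening_subset_of_subset _ Set.inter_subset_right))
  linarith

lemma dfc_step {x y : ℝ} (h : x ≤ y) :
    dfc μ ν δ (Set.Iic y) - dfc μ ν δ (Set.Iic x) ≤ cdf μ y - cdf μ x := by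
  have h1 := dfc_le_add (μ := μ) (ν := ν) (δ := δ) (S := Set.Iic x) (T := Set.Ioc x y)
    measurableSet_Iic
  rw [Set.Iic_union_Ioc_eq_Iic h] at h1
  have h2 : μ.real (Set.Iic x ∪ Set.Ioc x y) = μ.real (Set.Iic x) + μ.real (Set.Ioc x y) :=
    measureReal_union (by
      rw [Set.disjoint_left]; intro z hz hz'; exact absurd hz'.1 (not_lt.2 hz)) measurableSet_Ioc
  rw [Set.Iic_union_Ioc_eq_Iic h] at h2
  rw [cdf_eq_real, cdf_eq_real]
  linarith

variable (μ ν δ) in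
noncomputable def dSt : StieltjesFunction ℝ where
  toFun x := dfc μ ν δ (Set.Iic x)
  mono' x y h := dfc_mono (Set.Iic_subset_Iic.2 h)
  right_continuous' x := by
    have hc := (cdf μ).right_continuous x
    have h1 : Filter.Tendsto (fun y => dfc μ ν δ (Set.Iic x) + (cdf μ y - cdf μ x))
        (nhdsWithin x (Set.Ici x)) (nhds (dfc μ ν δ (Set.Iic x))) := by
      have := (hc.tendsto.sub_const (cdf μ x)).const_add (dfc μ ν δ (Set.Iic x))
      simpa using this
    refine tendsto_of_tendsto_of_tendsto_of_le_of_le' tendsto_const_nhds h1 ?_ ?_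
    · filter_upwards [self_mem_nhdsWithin] with y hy
      exact dfc_mono (Set.Iic_subset_Iic.2 hy)
    · filter_upwards [self_mem_nhdsWithin] with y hy
      have := dfc_step (μ := μ) (ν := ν) (δ := δ) (Set.mem_Ici.1 hy)
      linarith

variable (μ ν δ) in
noncomputable def rSt : StieltjesFunction ℝ where
  toFun x := cdf μ x - dfc μ ν δ (Set.Iic x)
  mono' x y h := by
    have := dfc_step (μ := μ) (ν := ν) (δ := δ) h
    dsimp only
    linarith
  right_continuous' x :=
    ((cdf μ).right_continuous x).sub ((dSt μ ν δ).right_continuous x)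

lemma St_add : (rSt μ ν δ).measure + (dSt μ ν δ).measure = μ := by
  rw [← StieltjesFunction.measure_add]
  conv_rhs => rw [← measure_cdf μ]
  congr 1
  ext x
  simp [rSt, dSt]

lemma dSt_univ (h : ∀ A : Set ℝ, MeasurableSet A →
      μ.real A ≤ ν.real (Metric.cthickening δ A) + ε) :
    (dSt μ ν δ).measure Set.univ ≤ ENNReal.ofReal ε := by
  have h1 : Filter.Tendsto (fun n : ℕ => (dSt μ ν δ).measure (Set.Ioc (-n : ℝ) n)) Filter.atTop
      (nhds ((dSt μ ν δ).measure (⋃ n : ℕ, Set.Ioc (-n : ℝ) n))) := by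
    apply tendsto_measure_iUnion_atTop
    intro a b hab
    have : (a : ℝ) ≤ b := by exact_mod_cast hab
    exact Set.Ioc_subset_Ioc (by linarith) this
  have h2 : (⋃ n : ℕ, Set.Ioc (-n : ℝ) n) = Set.univ := by
    refine Set.eq_univ_of_forall fun x => ?_
    obtain ⟨n, hn⟩ := exists_nat_gt |x|
    have := abs_lt.1 hn
    exact Set.mem_iUnion.2 ⟨n, this.1, this.2.le⟩
  rw [h2] at h1
  refine le_of_tendsto' h1 fun n => ?_
  rw [StieltjesFunction.measure_Ioc]
  apply ENNReal.ofReal_le_ofReal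
  have h3 : dfc μ ν δ (Set.Iic (n : ℝ)) ≤ ε := dfc_le fun A _ hm => by
    have := h A hm; linarith
  have h4 := dfc_nonneg (μ := μ) (ν := ν) (δ := δ) (Set.Iic (-n : ℝ))
  simp only [dSt]
  linarith

/-- key greedy inequality on unions of grid cells -/
lemma grid_ineq [IsFiniteMeasure (dSt μ ν δ).measure] (x : ℕ → ℝ) (hx : Monotone x)
    (S : Set ℝ) (h0 : S ∩ Set.Iic (x 0) = ∅)
    (hcell : ∀ k, Set.Ioc (x k) (x (k+1)) ⊆ S ∨ Set.Ioc (x k) (x (k+1)) ∩ S = ∅) (k : ℕ) :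
    dfc μ ν δ (S ∩ Set.Iic (x k)) ≤ (dSt μ ν δ).measure.real (S ∩ Set.Iic (x k)) := by
  induction k with
  | zero =>
    rw [h0]
    refine dfc_le fun A hA _ => ?_
    rw [Set.subset_empty_iff.1 hA]
    simp
  | succ k ih =>
    have hk : x k ≤ x (k+1) := hx (Nat.le_succ k)
    rcases hcell k with h | h
    · have e1 : S ∩ Set.Iic (x (k+1)) = (S ∩ Set.Iic (x k)) ∪ Set.Ioc (x k) (x (k+1)) := by
        ext z
        have := @h z
        simp only [Set.mem_inter_iff, Set.mem_Iic, Set.mem_union, Set.mem_Ioc] at *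
        grind
      have e2 : (S ∩ Set.Iic (x (k+1))) ∪ Set.Iic (x k) = Set.Iic (x (k+1)) := by
        ext z
        have := @h z
        simp only [Set.mem_inter_iff, Set.mem_Iic, Set.mem_union, Set.mem_Ioc] at *
        grind
      have e3 : (S ∩ Set.Iic (x (k+1))) ∩ Set.Iic (x k) = S ∩ Set.Iic (x k) := by
        ext z
        simp only [Set.mem_inter_iff, Set.mem_Iic] at *
        grind
      have h1 := dfc_super (μ := μ) (ν := ν) (δ := δ) (S ∩ Set.Iic (x (k+1))) (Set.Iic (x k))
      rw [e2, e3] at h1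
      have h2 : (dSt μ ν δ).measure.real (S ∩ Set.Iic (x (k+1))) =
          (dSt μ ν δ).measure.real (S ∩ Set.Iic (x k)) +
          (dSt μ ν δ).measure.real (Set.Ioc (x k) (x (k+1))) := by
        rw [e1]
        refine measureReal_union ?_ measurableSet_Ioc
        rw [Set.disjoint_left]; intro z hz hz'; exact absurd hz'.1 (not_lt.2 hz.2)
      have h3 : (dSt μ ν δ).measure.real (Set.Ioc (x k) (x (k+1))) =
          dfc μ ν δ (Set.Iic (x (k+1))) - dfc μ ν δ (Set.Iic (x k)) := by
        rw [measureReal_def, StieltjesFunction.measure_Ioc, ENNReal.toReal_ofReal]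
        · rfl
        · exact sub_nonneg.2 ((dSt μ ν δ).mono hk)
      linarith
    · have e1 : S ∩ Set.Iic (x (k+1)) = S ∩ Set.Iic (x k) := by
        ext z
        have : z ∉ Set.Ioc (x k) (x (k+1)) ∩ S := by rw [h]; simp
        simp only [Set.mem_inter_iff, Set.mem_Iic, Set.mem_Ioc] at *
        grind
      rw [e1]; exact ih

lemma rSt_compact (hδ : 0 ≤ δ) (K : Set ℝ) (n : ℝ) (hKn : K ⊆ Set.Icc (-n) n) (η : ℝ) (hη : 0 < η)
    [IsFiniteMeasure (dSt μ ν δ).measure] [IsFiniteMeasure (rSt μ ν δ).measure] :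
    (rSt μ ν δ).measure K ≤ ν (Metric.cthickening η (Metric.cthickening δ K)) := by
  set x : ℕ → ℝ := fun k => -n - 1 + k * η with hxdef
  have hx : Monotone x := by
    intro a b hab
    have : (a : ℝ) ≤ b := by exact_mod_cast hab
    simp only [hxdef]
    nlinarith
  have hxs : ∀ k, x (k+1) = x k + η := by intro k; simp only [hxdef]; push_cast; ring
  set S : Set ℝ := ⋃ k ∈ {k : ℕ | (Set.Ioc (x k) (x (k+1)) ∩ K).Nonempty}, Set.Ioc (x k) (x (k+1))
    with hS
  have hSm : MeasurableSet S :=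
    MeasurableSet.biUnion (Set.to_countable _) fun _ _ => measurableSet_Ioc
  have hdisj : ∀ j k z, z ∈ Set.Ioc (x j) (x (j+1)) → z ∈ Set.Ioc (x k) (x (k+1)) → j = k := by
    intro j k z hj hk
    by_contra hne
    rcases lt_or_gt_of_ne hne with h | h
    · exact absurd (hk.1) (not_lt.2 (hj.2.trans (hx h)))
    · exact absurd (hj.1) (not_lt.2 (hk.2.trans (hx h)))
  have hmem : ∀ z, z ∈ S ↔ ∃ k, (Set.Ioc (x k) (x (k+1)) ∩ K).Nonempty ∧
      z ∈ Set.Ioc (x k) (x (k+1)) := by 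
    intro z
    simp only [hS, Set.mem_iUnion, Set.mem_ofPred_eq, exists_prop]
  obtain ⟨N, hN⟩ := exists_nat_gt ((2 * n + 1) / η)
  have hN' : n ≤ x N := by
    rw [div_lt_iff₀ hη] at hN
    simp only [hxdef]; linarith
  have h0 : S ∩ Set.Iic (x 0) = ∅ := by
    ext z
    simp only [Set.mem_inter_iff, Set.mem_Iic, Set.mem_empty_iff_false, iff_false, not_and, not_le]
    intro hz
    obtain ⟨k, -, hk⟩ := (hmem z).1 hz
    exact (hx (Nat.zero_le k)).trans_lt hk.1
  have hcell : ∀ k, Set.Ioc (x k) (x (k+1)) ⊆ S ∨ Set.Ioc (x k) (x (k+1)) ∩ S = ∅ := by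
    intro k
    by_cases h : (Set.Ioc (x k) (x (k+1)) ∩ K).Nonempty
    · exact Or.inl fun z hz => (hmem z).2 ⟨k, h, hz⟩
    · right
      ext z
      simp only [Set.mem_inter_iff, Set.mem_empty_iff_false, iff_false, not_and]
      intro hz hzS
      obtain ⟨j, hj, hzj⟩ := (hmem z).1 hzS
      rw [hdisj j k z hzj hz] at hj
      exact h hj
  have hg := grid_ineq (μ := μ) (ν := ν) (δ := δ) x hx S h0 hcell N
  set T := S ∩ Set.Iic (x N) with hT
  have hTm : MeasurableSet T := hSm.inter measurableSet_Iic
  have hKT : K ⊆ T := by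
    intro z hz
    have hzn := hKn hz
    refine ⟨(hmem z).2 ?_, hzn.2.trans hN'⟩
    have hpos : 0 < (z - (-n-1)) / η := div_pos (by linarith [hzn.1]) hη
    have hcpos : 0 < ⌈(z - (-n-1)) / η⌉₊ := Nat.ceil_pos.2 hpos
    obtain ⟨k, hk⟩ := Nat.exists_eq_succ_of_ne_zero hcpos.ne'
    have hle := Nat.le_ceil ((z - (-n-1)) / η)
    have hlt := Nat.ceil_lt_add_one hpos.le
    rw [hk] at hle hlt
    push_cast at hle hlt
    rw [div_le_iff₀ hη] at hle
    have hlt' : (k : ℝ) < (z - (-n-1)) / η := by linarith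
    rw [lt_div_iff₀ hη] at hlt'
    have hzk : z ∈ Set.Ioc (x k) (x (k+1)) := by
      constructor
      · simp only [hxdef]; linarith
      · simp only [hxdef]; push_cast; linarith
    exact ⟨k, ⟨z, hzk, hz⟩, hzk⟩
  have hTK : T ⊆ Metric.cthickening η K := by
    rintro z ⟨hz, -⟩
    obtain ⟨k, ⟨w, hw, hwK⟩, hzk⟩ := (hmem z).1 hz
    refine Metric.closedBall_subset_cthickening hwK η ?_
    rw [Metric.mem_closedBall, Real.dist_eq, abs_le]
    have := hxs k
    constructor <;> linarith [hw.1, hw.2, hzk.1, hzk.2]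
  have h1 := le_dfc (μ := μ) (ν := ν) (δ := δ) (subset_refl T) hTm
  have h2 : μ.real T = (rSt μ ν δ).measure.real T + (dSt μ ν δ).measure.real T := by
    conv_lhs => rw [← St_add (μ := μ) (ν := ν) (δ := δ)]
    exact measureReal_add_apply
  have h3 : (rSt μ ν δ).measure.real T ≤ ν.real (Metric.cthickening δ T) := by linarith
  have h4 : (rSt μ ν δ).measure T ≤ ν (Metric.cthickening δ T) :=
    (ENNReal.toReal_le_toReal (measure_ne_top _ _) (measure_ne_top _ _)).1 h3
  refine (measure_mono hKT).trans (h4.trans (measure_mono ?_))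
  rw [cthickening_cthickening hη.le hδ, add_comm, ← cthickening_cthickening hδ hη.le]
  exact Metric.cthickening_subset_of_subset _ hTK

end

lemma greedy (μ ν : Measure ℝ) [IsProbabilityMeasure μ] [IsFiniteMeasure ν] (δ ε : ℝ) (hδ : 0 ≤ δ)
    (h : ∀ A : Set ℝ, MeasurableSet A →
      μ.real A ≤ ν.real (Metric.cthickening δ A) + ε) :
    ∃ μ' a : Measure ℝ, IsFiniteMeasure μ' ∧ IsFiniteMeasure a ∧ μ' + a = μ ∧
      a Set.univ ≤ ENNReal.ofReal ε ∧
      ∀ A, IsClosed A → μ' A ≤ ν (Metric.cthickening δ A) := by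
  have hsum := St_add (μ := μ) (ν := ν) (δ := δ)
  have i1 : IsFiniteMeasure (rSt μ ν δ).measure :=
    isFiniteMeasure_of_le μ (by conv_rhs => rw [← hsum]
                                exact Measure.le_add_right le_rfl)
  have i2 : IsFiniteMeasure (dSt μ ν δ).measure :=
    isFiniteMeasure_of_le μ (by conv_rhs => rw [← hsum]
                                exact Measure.le_add_left le_rfl)
  refine ⟨(rSt μ ν δ).measure, (dSt μ ν δ).measure, i1, i2, hsum, dSt_univ h, ?_⟩
  intro A hA
  have h1 : Filter.Tendsto (fun n : ℕ => (rSt μ ν δ).measure (A ∩ Set.Icc (-n : ℝ) n)) Filter.atTop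
      (nhds ((rSt μ ν δ).measure (⋃ n : ℕ, A ∩ Set.Icc (-n : ℝ) n))) := by
    apply tendsto_measure_iUnion_atTop
    intro a b hab
    have : (a : ℝ) ≤ b := by exact_mod_cast hab
    exact Set.inter_subset_inter_right _ (Set.Icc_subset_Icc (by linarith) this)
  have h2 : (⋃ n : ℕ, A ∩ Set.Icc (-n : ℝ) n) = A := by
    ext x
    simp only [Set.mem_iUnion, Set.mem_inter_iff, exists_and_left, and_iff_left_iff_imp]
    intro _
    obtain ⟨n, hn⟩ := exists_nat_gt |x|
    have := abs_lt.1 hn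
    exact ⟨n, this.1.le, this.2.le⟩
  rw [h2] at h1
  refine le_of_tendsto' h1 fun n => ?_
  have h3 : Filter.Tendsto (fun r => ν (Metric.cthickening r (Metric.cthickening δ A)))
      (nhdsWithin 0 (Set.Ioi 0)) (nhds (ν (Metric.cthickening δ A))) :=
    (tendsto_measure_cthickening_of_isClosed ⟨1, one_pos, measure_ne_top _ _⟩
      Metric.isClosed_cthickening).mono_left nhdsWithin_le_nhds
  refine ge_of_tendsto h3 ?_
  filter_upwards [self_mem_nhdsWithin] with η hη
  refine (rSt_compact hδ _ n Set.inter_subset_right η hη).trans (measure_mono ?_)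
  exact Metric.cthickening_subset_of_subset _
    (Metric.cthickening_subset_of_subset _ Set.inter_subset_left)

lemma compl_ineq (α β : Measure ℝ) [IsFiniteMeasure α] [IsFiniteMeasure β] (δ : ℝ) (hδ : 0 < δ)
    (h : ∀ A, IsClosed A → α A ≤ β (Metric.cthickening δ A)) (B : Set ℝ) (hB : MeasurableSet B) :
    β B + α Set.univ ≤ α (Metric.cthickening δ B) + β Set.univ := by
  have h3 : Filter.Tendsto (fun r => α (Metric.cthickening r (Metric.cthickening δ B)) +
      β Set.univ)
      (nhdsWithin 0 (Set.Ioi 0)) (nhds (α (Metric.cthickening δ B) + β Set.univ)) :=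
    ((tendsto_measure_cthickening_of_isClosed ⟨1, one_pos, measure_ne_top _ _⟩
      Metric.isClosed_cthickening).mono_left nhdsWithin_le_nhds).add tendsto_const_nhds
  refine ge_of_tendsto h3 ?_
  filter_upwards [self_mem_nhdsWithin] with η hη
  have hη : 0 < η := hη
  set T := Metric.thickening (δ + η) B with hT
  have hTo : IsOpen T := Metric.isOpen_thickening
  have h1 := h Tᶜ hTo.isClosed_compl
  have hdis : Disjoint B (Metric.cthickening δ Tᶜ) := by
    rw [Set.disjoint_left]
    intro b hb hb'
    have := Metric.cthickening_subset_thickening' (by linarith : 0 < δ + η) (by linarith) _ hb'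
    obtain ⟨z, hz, hbz⟩ := Metric.mem_thickening_iff.1 this
    exact hz (Metric.mem_thickening_iff.2 ⟨b, hb, by rwa [dist_comm]⟩)
  have h2 : β B + β (Metric.cthickening δ Tᶜ) ≤ β Set.univ := by
    rw [← measure_union hdis Metric.isClosed_cthickening.measurableSet]
    exact measure_mono (Set.subset_univ _)
  have h4 : α T + α Tᶜ = α Set.univ := measure_add_measure_compl hTo.measurableSet
  have h5 : α T ≤ α (Metric.cthickening η (Metric.cthickening δ B)) := by
    refine measure_mono ?_
    rw [cthickening_cthickening hη.le hδ.le, add_comm]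
    exact Metric.thickening_subset_cthickening _ _
  calc β B + α Set.univ = α T + (β B + α Tᶜ) := by rw [← h4]; ring
    _ ≤ _ := add_le_add h5 ((add_le_add_right h1 _).trans h2)

lemma quant (α : Measure ℝ) [IsProbabilityMeasure α] : ∃ Q : ℝ → ℝ, Measurable Q ∧
    (volume.restrict (Set.Ioo (0:ℝ) 1)).map Q = α ∧
    ∀ u ∈ Set.Ioo (0:ℝ) 1, ∀ x, Q u ≤ x ↔ u ≤ cdf α x := by
  classical
  set Q : ℝ → ℝ := fun u => if u ∈ Set.Ioo (0:ℝ) 1 then sInf {x | u ≤ cdf α x} else 0 with hQ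
  have key : ∀ u ∈ Set.Ioo (0:ℝ) 1, ∀ x, Q u ≤ x ↔ u ≤ cdf α x := by
    intro u hu x
    have hQu : Q u = sInf {x | u ≤ cdf α x} := by simp only [hQ]; rw [if_pos hu]
    have hne : {x | u ≤ cdf α x}.Nonempty := by
      obtain ⟨y, hy⟩ := ((tendsto_cdf_atTop α).eventually (lt_mem_nhds hu.2)).exists
      exact ⟨y, le_of_lt hy⟩
    have hbdd : BddBelow {x | u ≤ cdf α x} := by
      obtain ⟨y, hy⟩ := ((tendsto_cdf_atBot α).eventually (gt_mem_nhds hu.1)).exists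
      refine ⟨y, fun z hz => ?_⟩
      by_contra hlt
      exact absurd (hz.trans ((cdf α).mono (not_le.1 hlt).le)) (not_le.2 hy)
    rw [hQu]
    constructor
    · intro hle
      have hc : Filter.Tendsto (cdf α) (nhdsWithin x (Set.Ioi x)) (nhds (cdf α x)) :=
        ((cdf α).right_continuous x).mono_left (nhdsWithin_mono _ Set.Ioi_subset_Ici_self)
      refine ge_of_tendsto hc ?_
      filter_upwards [self_mem_nhdsWithin] with y hy
      obtain ⟨z, hz, hzy⟩ := exists_lt_of_csInf_lt hne (hle.trans_lt hy)
      exact le_trans hz ((cdf α).mono hzy.le)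
    · intro h
      exact csInf_le hbdd h
  have hpre : ∀ x, Q ⁻¹' Set.Iic x ∩ Set.Ioo 0 1 = Set.Ioo 0 1 ∩ Set.Iic (cdf α x) := by
    intro x
    ext u
    constructor
    · rintro ⟨h1, h2⟩; exact ⟨h2, (key u h2 x).1 h1⟩
    · rintro ⟨h1, h2⟩; exact ⟨(key u h1 x).2 h2, h1⟩
  have hQm : Measurable Q := by
    refine measurable_of_Iic fun x => ?_
    have : Q ⁻¹' Set.Iic x = (Q ⁻¹' Set.Iic x ∩ Set.Ioo 0 1) ∪
        (Q ⁻¹' Set.Iic x ∩ (Set.Ioo 0 1)ᶜ) := (Set.inter_union_compl _ _).symm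
    rw [this, hpre]
    refine (measurableSet_Ioo.inter measurableSet_Iic).union ?_
    by_cases hx : 0 ≤ x
    · convert (measurableSet_Ioo (a := (0:ℝ)) (b := 1)).compl using 1
      ext u
      simp only [Set.mem_inter_iff, and_iff_right_iff_imp]
      intro hu
      change Q u ≤ x
      simp only [hQ]
      rwa [if_neg hu]
    · convert MeasurableSet.empty using 1
      ext u
      simp only [Set.mem_inter_iff, Set.mem_empty_iff_false, iff_false, not_and]
      intro h hu
      change Q u ≤ x at h
      simp only [hQ] at h
      rw [if_neg hu] at h
      exact hx h
  refine ⟨Q, hQm, ?_, key⟩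
  have : IsFiniteMeasure ((volume.restrict (Set.Ioo (0:ℝ) 1)).map Q) := by infer_instance
  refine Measure.ext_of_Iic _ _ fun x => ?_
  rw [Measure.map_apply hQm measurableSet_Iic, Measure.restrict_apply (hQm measurableSet_Iic), hpre,
    ← ofReal_cdf]
  have h1 := cdf_le_one α x
  have h0 := cdf_nonneg α x
  refine le_antisymm ?_ ?_
  · calc volume (Set.Ioo (0:ℝ) 1 ∩ Set.Iic (cdf α x)) ≤ volume (Set.Ioc 0 (cdf α x)) := measure_mono fun u hu => ⟨hu.1.1, hu.2⟩
      _ = _ := by simp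
  · calc _ = volume (Set.Ioo 0 (cdf α x)) := by simp
      _ ≤ volume (Set.Ioo (0:ℝ) 1 ∩ Set.Iic (cdf α x)) :=
          measure_mono fun u hu => ⟨⟨hu.1, hu.2.trans_le h1⟩, hu.2.le⟩

lemma cthick_Iic (δ y : ℝ) (hδ : 0 ≤ δ) :
    Metric.cthickening δ (Set.Iic y) ⊆ Set.Iic (y + δ) := by
  rw [Metric.cthickening_eq_biUnion_closedBall _ hδ, isClosed_Iic.closure_eq]
  intro z hz
  simp only [Set.mem_iUnion, exists_prop] at hz
  obtain ⟨w, hw, hz⟩ := hz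
  rw [Metric.mem_closedBall, Real.dist_eq] at hz
  have := (abs_le.1 hz).2
  simp only [Set.mem_Iic] at *
  linarith

lemma coup0 (α β : Measure ℝ) [IsFiniteMeasure α] [IsFiniteMeasure β] (δ : ℝ)
    (hm : α Set.univ = β Set.univ)
    (h1 : ∀ x, α (Set.Iic x) ≤ β (Set.Iic (x + δ)))
    (h2 : ∀ x, β (Set.Iic x) ≤ α (Set.Iic (x + δ))) :
    ∃ ρ : Measure (ℝ × ℝ), ρ.fst = α ∧ ρ.snd = β ∧ ρ {p | δ < |p.1 - p.2|} = 0 := by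
  by_cases h0 : α Set.univ = 0
  · refine ⟨0, ?_, ?_, by simp⟩
    · rw [Measure.measure_univ_eq_zero.1 h0]; simp
    · rw [hm] at h0
      rw [Measure.measure_univ_eq_zero.1 h0]; simp
  set m := α Set.univ with hmdef
  have hmt : m ≠ ⊤ := measure_ne_top _ _
  have hmm : m * m⁻¹ = 1 := ENNReal.mul_inv_cancel h0 hmt
  have hmm' : m⁻¹ * m = 1 := by rw [mul_comm]; exact hmm
  have p1 : IsProbabilityMeasure (m⁻¹ • α) := ⟨by simp [← hmdef, hmm']⟩
  have p2 : IsProbabilityMeasure (m⁻¹ • β) := ⟨by simp [← hm, hmm']⟩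
  obtain ⟨Q, hQm, hQ, hQk⟩ := quant (m⁻¹ • α)
  obtain ⟨R, hRm, hR, hRk⟩ := quant (m⁻¹ • β)
  have c1 : ∀ x, cdf (m⁻¹ • α) x ≤ cdf (m⁻¹ • β) (x + δ) := by
    intro x
    rw [cdf_eq_real, cdf_eq_real]
    refine ENNReal.toReal_mono (measure_ne_top _ _) ?_
    simp only [Measure.smul_apply, smul_eq_mul]
    exact mul_le_mul_right (h1 x) _
  have c2 : ∀ x, cdf (m⁻¹ • β) x ≤ cdf (m⁻¹ • α) (x + δ) := by
    intro x
    rw [cdf_eq_real, cdf_eq_real]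
    refine ENNReal.toReal_mono (measure_ne_top _ _) ?_
    simp only [Measure.smul_apply, smul_eq_mul]
    exact mul_le_mul_right (h2 x) _
  have hQR : Measurable fun u => (Q u, R u) := hQm.prodMk hRm
  refine ⟨m • (volume.restrict (Set.Ioo (0:ℝ) 1)).map (fun u => (Q u, R u)), ?_, ?_, ?_⟩
  · rw [Measure.fst, Measure.map_smul, Measure.map_map measurable_fst hQR]
    change m • Measure.map Q _ = α
    rw [hQ, smul_smul, hmm, one_smul]
  · rw [Measure.snd, Measure.map_smul, Measure.map_map measurable_snd hQR]
    change m • Measure.map R _ = β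
    rw [hR, smul_smul, hmm, one_smul]
  · have hmeas : MeasurableSet {p : ℝ × ℝ | δ < |p.1 - p.2|} :=
      measurableSet_lt measurable_const (by fun_prop)
    rw [Measure.smul_apply, Measure.map_apply hQR hmeas,
      Measure.restrict_apply (hQR hmeas)]
    have : ((fun u => (Q u, R u)) ⁻¹' {p : ℝ × ℝ | δ < |p.1 - p.2|} ∩ Set.Ioo 0 1) = ∅ := by
      ext u
      simp only [Set.mem_inter_iff, Set.mem_empty_iff_false, iff_false, not_and]
      intro h hu
      change δ < |Q u - R u| at h
      have a1 : u ≤ cdf (m⁻¹ • α) (Q u) := (hQk u hu _).1 le_rfl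
      have a2 : u ≤ cdf (m⁻¹ • β) (R u) := (hRk u hu _).1 le_rfl
      have b1 := (hRk u hu _).2 (a1.trans (c1 _))
      have b2 := (hQk u hu _).2 (a2.trans (c2 _))
      refine absurd h (not_lt.2 (abs_le.2 ⟨by linarith, by linarith⟩))
    rw [this]; simp

lemma coup (μ ν : Measure ℝ) [IsProbabilityMeasure μ] [IsProbabilityMeasure ν]
    (ε δ : ℝ) (hε : 0 < ε) (hδ : 0 < δ)
    (hclose : ∀ A : Set ℝ, MeasurableSet A →
      μ A ≤ ν (Metric.cthickening δ A) + ENNReal.ofReal ε) :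
    ∃ π : Measure (ℝ × ℝ), π.fst = μ ∧ π.snd = ν ∧
      π {p | δ < |p.1 - p.2|} ≤ ENNReal.ofReal ε := by
  obtain ⟨μ', a, fμ, fa, hμ, ha, hμ'⟩ := greedy μ ν δ ε hδ.le (by
    intro A hA
    have := ENNReal.toReal_mono (by finiteness) (hclose A hA)
    rwa [ENNReal.toReal_add (measure_ne_top _ _) ENNReal.ofReal_ne_top,
      ENNReal.toReal_ofReal hε.le] at this)
  have hμu : μ' Set.univ + a Set.univ = 1 := by
    rw [← Measure.add_apply, hμ]; exact measure_univ
  obtain ⟨ν', b, fν, fb, hν, hb, hν'⟩ := greedy ν μ' δ (a.real Set.univ) hδ.le (by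
    intro B hB
    have h1 := compl_ineq μ' ν δ hδ hμ' B hB
    rw [measure_univ (μ := ν), ← hμu, add_comm (μ' Set.univ), ← add_assoc] at h1
    have h2 := (ENNReal.add_le_add_iff_right (measure_ne_top μ' Set.univ)).1 h1
    have := ENNReal.toReal_mono (by finiteness) h2
    rwa [ENNReal.toReal_add (measure_ne_top _ _) (measure_ne_top _ _)] at this)
  rw [measureReal_def, ENNReal.ofReal_toReal (measure_ne_top _ _)] at hb
  have hνu : ν' Set.univ + b Set.univ = 1 := by
    rw [← Measure.add_apply, hν]; exact measure_univ
  have hle : ν' Set.univ ≤ μ' Set.univ :=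
    (hν' _ isClosed_univ).trans (measure_mono (Set.subset_univ _))
  have hge : μ' Set.univ ≤ ν' Set.univ := by
    have : μ' Set.univ + a Set.univ ≤ ν' Set.univ + a Set.univ := by
      rw [hμu, ← hνu]; gcongr
    exact (ENNReal.add_le_add_iff_right (measure_ne_top a Set.univ)).1 this
  have hmass : μ' Set.univ = ν' Set.univ := le_antisymm hge hle
  have hab : a Set.univ = b Set.univ := by
    rw [← hνu, ← hmass] at hμu
    exact (ENNReal.add_right_inj (measure_ne_top μ' Set.univ)).1 hμu
  have k2 : ∀ x, ν' (Set.Iic x) ≤ μ' (Set.Iic (x + δ)) := fun x =>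
    (hν' _ isClosed_Iic).trans (measure_mono (cthick_Iic δ x hδ.le))
  have k1 : ∀ x, μ' (Set.Iic x) ≤ ν' (Set.Iic (x + δ)) := fun x => by
    have h1 := compl_ineq ν' μ' δ hδ hν' (Set.Iic x) measurableSet_Iic
    rw [hmass] at h1
    exact ((ENNReal.add_le_add_iff_right (measure_ne_top ν' Set.univ)).1 h1).trans
      (measure_mono (cthick_Iic δ x hδ.le))
  obtain ⟨ρ, hρ1, hρ2, hρ3⟩ := coup0 μ' ν' δ hmass k1 k2
  set c := a Set.univ with hc
  have hct : c ≠ ⊤ := measure_ne_top _ _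
  refine ⟨ρ + c⁻¹ • a.prod b, ?_, ?_, ?_⟩
  · rw [Measure.fst_add, hρ1, ← hμ]
    congr 1
    rw [Measure.fst, Measure.map_smul, Measure.map_fst_prod, ← hab, smul_smul]
    by_cases h0 : c = 0
    · rw [Measure.measure_univ_eq_zero.1 h0]; simp
    · rw [ENNReal.inv_mul_cancel h0 hct, one_smul]
  · rw [Measure.snd_add, hρ2, ← hν]
    congr 1
    rw [Measure.snd, Measure.map_smul, Measure.map_snd_prod, ← hc, smul_smul]
    by_cases h0 : c = 0
    · rw [hab] at h0
      rw [Measure.measure_univ_eq_zero.1 h0]; simp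
    · rw [ENNReal.inv_mul_cancel h0 hct, one_smul]
  · rw [Measure.add_apply, hρ3, zero_add, Measure.smul_apply, smul_eq_mul]
    refine le_trans ?_ ha
    calc c⁻¹ * (a.prod b) _ ≤ c⁻¹ * (a.prod b) Set.univ := by
          gcongr; exact Set.subset_univ _
      _ = (c⁻¹ * c) * c := by
          rw [← Set.univ_prod_univ, Measure.prod_prod, ← hab, mul_assoc]
      _ ≤ 1 * c := by gcongr; exact ENNReal.inv_mul_le_one c
      _ = c := one_mul c

theorem stmt18 {Ω : Type*} [MeasurableSpace Ω] (P : Measure Ω) [IsProbabilityMeasure P]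
    (μL νL : Measure ℝ) [IsProbabilityMeasure μL] [IsProbabilityMeasure νL]
    (ε δ : ℝ) (hε : 0 < ε) (hδ : 0 < δ)
    (hclose : ∀ A : Set ℝ, MeasurableSet A →
      μL A ≤ νL (Metric.cthickening δ A) + ENNReal.ofReal ε)
    (V U : Ω → ℝ) (hV : Measurable V) (hU : Measurable U)
    (hVlaw : Measure.map V P = μL)
    (hUlaw : Measure.map U P = volume.restrict (Set.Icc (0 : ℝ) 1))
    (hindep : IndepFun V U P) :
    ∃ W : Ω → ℝ, Measurable W ∧ Measure.map W P = νL ∧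
      P {ω | δ < |V ω - W ω|} ≤ ENNReal.ofReal ε := by
  obtain ⟨π, h1, h2, h3⟩ := coup μL νL ε δ hε hδ hclose
  have hπ : IsProbabilityMeasure π := ⟨by
    rw [← Measure.fst_univ, h1]; exact measure_univ⟩
  obtain ⟨f, hf, hfk⟩ := Kernel.exists_measurable_map_eq_unitInterval π.condKernel
  set g : ℝ × ℝ → ℝ := fun p => f p.1 (Set.projIcc 0 1 zero_le_one p.2) with hg
  have hpm : Measurable (Set.projIcc (0:ℝ) 1 zero_le_one) := continuous_projIcc.measurable
  have hgm : Measurable g :=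
    hf.comp (measurable_fst.prodMk (hpm.comp measurable_snd))
  have hgk : ∀ x, (volume.restrict (Set.Icc (0:ℝ) 1)).map (fun u => g (x, u)) =
      π.condKernel x := by
    intro x
    have hfx : Measurable (f x) := hf.of_uncurry_left
    have hgx : Measurable fun u => g (x, u) := hgm.comp measurable_prodMk_left
    rw [← hfk x, ← map_comap_subtype_coe measurableSet_Icc volume,
      Measure.map_map hgx measurable_subtype_coe]
    congr 1
    ext u
    simp [hg, Set.projIcc_val]
  have hVW : Measurable fun ω => (V ω, g (V ω, U ω)) :=
    hV.prodMk (hgm.comp (hV.prodMk hU))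
  have hlaw : P.map (fun ω => (V ω, g (V ω, U ω))) = π := by
    have e1 : P.map (fun ω => (V ω, U ω)) = μL.prod (volume.restrict (Set.Icc (0:ℝ) 1)) := by
      rw [(indepFun_iff_map_prod_eq_prod_map_map hV.aemeasurable hU.aemeasurable).1 hindep,
        hVlaw, hUlaw]
    have hk : Measurable fun p : ℝ × ℝ => (p.1, g p) := measurable_fst.prodMk hgm
    have e2 : P.map (fun ω => (V ω, g (V ω, U ω))) =
        (P.map (fun ω => (V ω, U ω))).map (fun p => (p.1, g p)) := by
      rw [Measure.map_map hk (hV.prodMk hU)]; rfl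
    rw [e2, e1]
    conv_rhs => rw [← π.disintegrate π.condKernel, h1]
    ext s hs
    rw [Measure.map_apply hk hs, Measure.prod_apply (hk hs), Measure.compProd_apply hs]
    refine lintegral_congr fun x => ?_
    have hgx : Measurable fun u => g (x, u) := hgm.comp measurable_prodMk_left
    rw [← hgk x, Measure.map_apply hgx (measurable_prodMk_left hs)]
    rfl
  refine ⟨fun ω => g (V ω, U ω), hgm.comp (hV.prodMk hU), ?_, ?_⟩
  · rw [← h2, ← hlaw, Measure.snd, Measure.map_map measurable_snd hVW]; rfl
  · have hmeas : MeasurableSet {p : ℝ × ℝ | δ < |p.1 - p.2|} :=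
      measurableSet_lt measurable_const (by fun_prop)
    rw [← hlaw, Measure.map_apply hVW hmeas] at h3
    exact h3
end

section
/- Let W = (W₁,…,W_N) be a Gaussian random vector (not necessarily centered) with min_j Var(W_j) ≥ σ̲² for some σ̲ > 0, and let W^∨ = max_j W_j. Then for all t ∈ ℝ and δ > 0, P(t < W^∨ ≤ t + δ) ≤ (δ/σ̲)(√(2 log N) + 2). -/
open MeasureTheory ProbabilityTheory

lemma shift1 (m ε : ℝ) (f : ℝ → ENNReal) (hf : Measurable f) :
    ∫⁻ x, f (x - ε) ∂(gaussianReal m 1) =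
      ∫⁻ x, f x * ENNReal.ofReal (Real.exp (-ε * (x - m) - ε ^ 2 / 2)) ∂(gaussianReal m 1) := by
  have h1 : ∫⁻ x, f (x - ε) ∂(gaussianReal m 1) = ∫⁻ x, f x ∂(gaussianReal (m - ε) 1) := by
    rw [← gaussianReal_map_sub_const, lintegral_map hf (by fun_prop)]
  rw [h1, gaussianReal_of_var_ne_zero _ one_ne_zero, gaussianReal_of_var_ne_zero _ one_ne_zero,
    lintegral_withDensity_eq_lintegral_mul _ (measurable_gaussianPDF _ _) hf,
    lintegral_withDensity_eq_lintegral_mul _ (measurable_gaussianPDF _ _) (by fun_prop)]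
  refine lintegral_congr fun x => ?_
  simp only [Pi.mul_apply]
  rw [mul_comm (f x), ← mul_assoc, gaussianPDF, gaussianPDF,
    ← ENNReal.ofReal_mul (gaussianPDFReal_nonneg _ _ _)]
  congr 2
  simp only [gaussianPDFReal]
  rw [mul_assoc _ (Real.exp _) (Real.exp _), ← Real.exp_add]
  congr 2
  simp
  ring

lemma gaussLaw {Ω : Type*} [MeasurableSpace Ω] (μ : Measure Ω) [IsProbabilityMeasure μ]
    (N : ℕ) (W : Ω → Fin N → ℝ)
    (hmeas : ∀ j, Measurable fun ω => W ω j)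
    (hgauss : ∀ a : Fin N → ℝ, ∃ (m : ℝ) (v : NNReal),
      Measure.map (fun ω => ∑ j, a j * W ω j) μ = gaussianReal m v) : HasGaussianLaw W μ := by
  have hW : Measurable W := measurable_pi_iff.2 hmeas
  constructor
  refine isGaussian_of_map_eq_gaussianReal fun L => ?_
  obtain ⟨m, v, h⟩ := hgauss (fun j => L (Pi.single j 1))
  refine ⟨m, v, ?_⟩
  rw [← h, Measure.map_map (by fun_prop) hW]
  congr 1
  ext ω
  simp only [Function.comp]
  conv_lhs => rw [← Finset.univ_sum_single (W ω), map_sum]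
  refine Finset.sum_congr rfl fun j _ => ?_
  have : Pi.single j (W ω j) = (W ω j) • (Pi.single j 1 : Fin N → ℝ) := by
    rw [← Pi.single_smul]; simp
  rw [this, map_smul, smul_eq_mul, mul_comm]

lemma cameron {Ω : Type*} [MeasurableSpace Ω] (μ : Measure Ω) [IsProbabilityMeasure μ]
    {N : ℕ} (W : Ω → Fin N → ℝ) (hW : Measurable W) (hG : HasGaussianLaw W μ) (j : Fin N)
    (s : ℝ) (hs : 0 < s) (hv : variance (fun ω => W ω j) μ = s ^ 2) (ε : ℝ)
    (F : (Fin N → ℝ) → ENNReal) (hF : Measurable F) :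
    ∫⁻ ω, F (fun k => W ω k - ε * (cov[fun ω => W ω k, fun ω => W ω j; μ] / s)) ∂μ =
      ∫⁻ ω, F (W ω) * ENNReal.ofReal
        (Real.exp (-ε * ((W ω j) / s - (∫ ω, W ω j / s ∂μ)) - ε ^ 2 / 2)) ∂μ := by
  set c : Fin N → ℝ := fun k => cov[fun ω => W ω k, fun ω => W ω j; μ] / s with hc
  set X : Ω → ℝ := fun ω => W ω j / s with hX
  set Y : Ω → Fin N → ℝ := fun ω k => W ω k - X ω * c k with hY
  have hWk : ∀ k, Measurable fun ω => W ω k := fun k => (measurable_pi_apply k).comp hW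
  have hGk : ∀ k, HasGaussianLaw (fun ω => W ω k) μ := fun k =>
    hG.map_fun (ContinuousLinearMap.proj (R := ℝ) (φ := fun _ : Fin N => ℝ) k)
  have hXm : Measurable X := (hWk j).div_const s
  have hYm : Measurable Y := measurable_pi_iff.2 fun k => (hWk k).sub (hXm.mul_const _)
  have hLX : HasGaussianLaw X μ := by
    have := hG.map_fun ((1 / s) • ContinuousLinearMap.proj (R := ℝ) (φ := fun _ : Fin N => ℝ) j)
    refine this.congr (ae_of_all _ fun ω => ?_)
    simp [hX]; ring
  have hXl : μ.map X = gaussianReal (∫ ω, X ω ∂μ) 1 := by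
    rw [hLX.map_eq_gaussianReal]
    congr 1
    have : Var[X; μ] = 1 := by
      rw [← covariance_self hXm.aemeasurable, hX, covariance_fun_div_left,
        covariance_fun_div_right, covariance_self (hWk j).aemeasurable, hv]
      field_simp
    rw [this]; simp
  have hjoint : HasGaussianLaw (fun ω => (fun _ : Unit => X ω, fun k => Y ω k)) μ := by
    let p : (Fin N → ℝ) →L[ℝ] ℝ :=
      (1 / s) • ContinuousLinearMap.proj (R := ℝ) (φ := fun _ : Fin N => ℝ) j
    have := hG.map_fun ((ContinuousLinearMap.pi (fun _ : Unit => p)).prod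
      (ContinuousLinearMap.pi fun k =>
        ContinuousLinearMap.proj (R := ℝ) (φ := fun _ : Fin N => ℝ) k - (c k) • p))
    refine this.congr (ae_of_all _ fun ω => ?_)
    ext k
    · simp [p, hX]; ring
    · simp [p, hX, hY]; ring
  have hind0 := HasGaussianLaw.indepFun_of_covariance_eval
    (X := fun _ : Unit => X) (Y := fun k ω => Y ω k) hjoint (by
      intro _ k
      simp only [hY]
      rw [covariance_fun_sub_right hLX.memLp_two (hGk k).memLp_two (hLX.memLp_two.mul_const _),
        covariance_mul_const_right]
      simp only [hX, hc]
      rw [covariance_fun_div_left, covariance_fun_div_left, covariance_fun_div_right,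
        covariance_self (hWk j).aemeasurable, hv, covariance_comm]
      field_simp
      ring)
  have hind : IndepFun X Y μ :=
    hind0.comp (φ := fun f : Unit → ℝ => f ()) (ψ := id) (by fun_prop) measurable_id
  have hprod := hind.map_prod_eq_prod_map_map hXm.aemeasurable hYm.aemeasurable
  have hWd : ∀ ω, W ω = fun k => X ω * c k + Y ω k := by
    intro ω; ext k; simp [hY]
  have e1 : ∀ G : ℝ × (Fin N → ℝ) → ENNReal, Measurable G → ∫⁻ ω, G (X ω, Y ω) ∂μ =
      ∫⁻ y, ∫⁻ x, G (x, y) ∂(gaussianReal (∫ ω, X ω ∂μ) 1) ∂(μ.map Y) := by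
    intro G hGm
    have : IsProbabilityMeasure (μ.map Y) := Measure.isProbabilityMeasure_map hYm.aemeasurable
    rw [← lintegral_map (f := G) (g := fun ω => (X ω, Y ω)) hGm (hXm.prodMk hYm), hprod, hXl,
      lintegral_prod_symm _ hGm.aemeasurable]
  have a1 := e1 (fun z => F (fun k => (z.1 - ε) * c k + z.2 k))
    (hF.comp (measurable_pi_iff.2 fun k => by fun_prop))
  have a2 := e1 (fun z => F (fun k => z.1 * c k + z.2 k) * ENNReal.ofReal
        (Real.exp (-ε * (z.1 - (∫ ω, X ω ∂μ)) - ε ^ 2 / 2)))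
    ((hF.comp (measurable_pi_iff.2 fun k => by fun_prop)).mul (by fun_prop))
  have b1 : ∀ ω, (fun k => W ω k - ε * c k) = fun k => (X ω - ε) * c k + Y ω k := by
    intro ω; ext k; simp [hY]; ring
  change ∫⁻ ω, F (fun k => W ω k - ε * c k) ∂μ = _
  simp_rw [b1]
  rw [a1]
  calc _ = _ := ?_
    _ = _ := a2.symm
    _ = _ := ?_
  · refine lintegral_congr fun y => ?_
    exact shift1 _ ε (fun x => F (fun k => x * c k + y k))
      (hF.comp (measurable_pi_iff.2 fun k => by fun_prop))
  · refine lintegral_congr fun ω => ?_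
    simp only [← hWd ω]
    rfl

lemma covH {Ω : Type*} [MeasurableSpace Ω] (μ : Measure Ω) [IsProbabilityMeasure μ]
    (A B : Ω → ℝ) (hA : MemLp A 2 μ) (hB : MemLp B 2 μ)
    (s r : ℝ) (hs : 0 < s) (hr : 0 < r) (hvA : variance A μ = s ^ 2) (hvB : variance B μ = r ^ 2) :
    cov[B, A; μ] / s ≤ r ∧ (cov[B, A; μ] / s = r →
      ∀ C : Ω → ℝ, MemLp C 2 μ → cov[C, A; μ] / s = cov[C, B; μ] / r) := by
  have hA' : MemLp (fun ω => A ω / s) 2 μ := by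
    simpa [div_eq_mul_inv] using hA.mul_const s⁻¹
  have hB' : MemLp (fun ω => B ω / r) 2 μ := by
    simpa [div_eq_mul_inv] using hB.mul_const r⁻¹
  have hD : MemLp (fun ω => A ω / s - B ω / r) 2 μ := hA'.sub hB'
  have hvar : variance (fun ω => A ω / s - B ω / r) μ = 2 - 2 * (cov[B, A; μ] / s / r) := by
    rw [← covariance_self hD.aemeasurable, covariance_fun_sub_fun_sub hA' hB' hA' hB']
    simp only [covariance_fun_div_left, covariance_fun_div_right]
    rw [covariance_self hA.aemeasurable, covariance_self hB.aemeasurable, hvA, hvB,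
      covariance_comm A B]
    field_simp
    ring
  constructor
  · have := variance_nonneg (fun ω => A ω / s - B ω / r) μ
    rw [hvar] at this
    have h2 : cov[B, A; μ] / s / r ≤ 1 := by linarith
    rwa [div_le_one hr] at h2
  · intro h C hC
    rw [h, div_self hr.ne', mul_one, sub_self] at hvar
    have hae := (ae_eq_integral_of_variance_eq_zero hD hvar)
    have h0 : cov[C, fun ω => A ω / s - B ω / r; μ] = 0 := by
      rw [covariance]
      apply integral_eq_zero_of_ae
      filter_upwards [hae] with ω hω
      simp only [Pi.zero_apply, mul_eq_zero]
      right; rw [hω]; simp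
    rw [covariance_fun_sub_right hC hA' hB', covariance_fun_div_right,
      covariance_fun_div_right] at h0
    linarith

/-- Region where `j` is the first argmax and the max exceeds `t`. -/
def regA {N : ℕ} (t : ℝ) (j : Fin N) : Set (Fin N → ℝ) :=
  {w | (∀ k, w k ≤ w j) ∧ (∀ k, k < j → w k < w j) ∧ t < w j}

lemma regA_meas {N : ℕ} (t : ℝ) (j : Fin N) : MeasurableSet (regA t j) := by
  have : regA t j = (⋂ k, {w : Fin N → ℝ | w k ≤ w j}) ∩
      ((⋂ k, ⋂ (_ : k < j), {w : Fin N → ℝ | w k < w j}) ∩ {w | t < w j}) := by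
    ext w; simp [regA]
  rw [this]
  refine (MeasurableSet.iInter fun k => measurableSet_le (by fun_prop) (by fun_prop)).inter
    ((MeasurableSet.iInter fun k => MeasurableSet.iInter fun _ =>
      measurableSet_lt (by fun_prop) (by fun_prop)).inter
      (measurableSet_lt (by fun_prop) (by fun_prop)))

lemma regA_exists {N : ℕ} (t : ℝ) (w : Fin N → ℝ) (h : ∃ k, t < w k) :
    ∃ j, w ∈ regA t j := by
  classical
  obtain ⟨k, hk⟩ := h
  let S : Finset (Fin N) := Finset.univ.filter fun j => ∀ k, w k ≤ w j
  have hS : S.Nonempty := by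
    obtain ⟨j, _, hj⟩ := Finset.exists_max_image Finset.univ w ⟨k, Finset.mem_univ k⟩
    exact ⟨j, by simpa [S] using hj⟩
  have hm : ∀ l, w l ≤ w (S.min' hS) := by
    have := S.min'_mem hS
    simpa [S] using this
  refine ⟨S.min' hS, hm, ?_, hk.trans_le (hm k)⟩
  intro l hl
  by_contra hcon
  push Not at hcon
  have : l ∈ S := by
    simp only [S, Finset.mem_filter, Finset.mem_univ, true_and]
    exact fun k => (hm k).trans hcon
  exact absurd (S.min'_le l this) (not_le.2 hl)

lemma regA_sum {N : ℕ} (t ε σ : ℝ) (hε : 0 < ε) (s : Fin N → ℝ) (c : Fin N → Fin N → ℝ)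
    (hsσ : ∀ j, σ ≤ s j) (hcs : ∀ j, c j j = s j) (hc1 : ∀ i j, c i j ≤ s j)
    (hc2 : ∀ i j, c i j = s j → c i = c j) (w : Fin N → ℝ) :
    ∑ j, (regA t j).indicator (fun _ => (1 : ENNReal)) (fun k => w k - ε * c j k) ≤
      {w : Fin N → ℝ | ∃ k, t + ε * σ < w k}.indicator (fun _ => 1) w := by
  classical
  by_cases h : ∃ j, (fun k => w k - ε * c j k) ∈ regA t j
  · obtain ⟨j, hj⟩ := h
    have hmem : w ∈ {w : Fin N → ℝ | ∃ k, t + ε * σ < w k} := by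
      refine ⟨j, ?_⟩
      have h3 := hj.2.2
      simp only [hcs] at h3
      nlinarith [mul_le_mul_of_nonneg_left (hsσ j) hε.le]
    rw [Set.indicator_of_mem hmem, Finset.sum_eq_single j, Set.indicator_of_mem hj]
    · intro i _ hij
      apply Set.indicator_of_notMem
      intro hi
      have a1 := hi.1 j
      have a2 := hj.1 i
      simp only [hcs] at a1 a2
      have a3 : s i + s j ≤ c i j + c j i := by
        have : ε * (s i + s j) ≤ ε * (c i j + c j i) := by linarith
        exact le_of_mul_le_mul_left this hε
      have a4 : c i = c j := hc2 i j (by linarith [hc1 i j, hc1 j i])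
      rw [a4] at hi
      rcases lt_or_gt_of_ne hij with h | h
      · exact absurd (hi.1 j) (not_le.2 (hj.2.1 i h))
      · exact absurd (hj.1 i) (not_le.2 (hi.2.1 j h))
    · simp
  · push Not at h
    rw [Finset.sum_eq_zero]
    · exact zero_le
    · intro j _
      exact Set.indicator_of_notMem (h j) _

lemma kappa (N : ℕ) (hN : 0 < N) :
    (N : ℝ) * (Real.exp ((Real.sqrt (2 * Real.log N) + 1) ^ 2 / 2
      - (Real.sqrt (2 * Real.log N) + 1) * Real.sqrt (2 * Real.log N) - 1) /
        (Real.sqrt (2 * Real.log N) + 1)) ≤ 1 := by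
  have hN' : (1 : ℝ) ≤ N := by exact_mod_cast hN
  have hl := Real.log_nonneg hN'
  have hu := Real.sq_sqrt (show 0 ≤ 2 * Real.log N by linarith)
  have hu0 := Real.sqrt_nonneg (2 * Real.log N)
  set u := Real.sqrt (2 * Real.log N)
  have e : (u + 1) ^ 2 / 2 - (u + 1) * u - 1 = - Real.log N + (- (1 / 2)) := by
    nlinarith
  rw [e, Real.exp_add, Real.exp_neg, Real.exp_log (by linarith), ← mul_div_assoc, ← mul_assoc,
    mul_inv_cancel₀ (by linarith), one_mul, div_le_one (by linarith)]
  have := Real.exp_le_one_iff.2 (show (-(1 / 2) : ℝ) ≤ 0 by norm_num)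
  linarith

lemma step {Ω : Type*} [MeasurableSpace Ω] (μ : Measure Ω) [IsProbabilityMeasure μ]
    {N : ℕ} (hN : 0 < N) (W : Ω → Fin N → ℝ) (hW : Measurable W) (hG : HasGaussianLaw W μ)
    (σ : ℝ) (hσ : 0 < σ) (hvar : ∀ j, σ ^ 2 ≤ variance (fun ω => W ω j) μ)
    (ε : ℝ) (hε : 0 < ε) (t : ℝ) :
    μ {ω | ∃ k, t < W ω k} ≤ μ {ω | ∃ k, t + ε * σ < W ω k} +
      ENNReal.ofReal (ε * (Real.sqrt (2 * Real.log N) + 1) + ε ^ 2 / 2) := by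
  have hWk : ∀ k, Measurable fun ω => W ω k := fun k => (measurable_pi_apply k).comp hW
  have hGk : ∀ k, HasGaussianLaw (fun ω => W ω k) μ := fun k =>
    hG.map_fun (ContinuousLinearMap.proj (R := ℝ) (φ := fun _ : Fin N => ℝ) k)
  let s : Fin N → ℝ := fun j => Real.sqrt (variance (fun ω => W ω j) μ)
  have hsσ : ∀ j, σ ≤ s j := fun j => Real.le_sqrt_of_sq_le (hvar j)
  have hs : ∀ j, 0 < s j := fun j => hσ.trans_le (hsσ j)
  have hsv : ∀ j, variance (fun ω => W ω j) μ = s j ^ 2 := fun j =>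
    (Real.sq_sqrt (variance_nonneg _ _)).symm
  let c : Fin N → Fin N → ℝ := fun j k => cov[fun ω => W ω k, fun ω => W ω j; μ] / s j
  have hcs : ∀ j, c j j = s j := by
    intro j
    simp only [c]
    rw [covariance_self (hWk j).aemeasurable, hsv j]
    have := (hs j).ne'
    field_simp
  have hH := fun i j => covH μ _ _ (hGk i).memLp_two (hGk j).memLp_two (s i) (s j) (hs i) (hs j)
    (hsv i) (hsv j)
  have hc1 : ∀ i j, c i j ≤ s j := fun i j => (hH i j).1
  have hc2 : ∀ i j, c i j = s j → c i = c j := fun i j h => by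
    ext k
    exact (hH i j).2 h _ (hGk k).memLp_two
  let X : Fin N → Ω → ℝ := fun j ω => W ω j / s j - ∫ ω, W ω j / s j ∂μ
  have hXm : ∀ j, Measurable (X j) := fun j => ((hWk j).div_const _).sub_const _
  have hCM := fun j (e : ℝ) => cameron μ W hW hG j (s j) (hs j) (hsv j) e
  set u := Real.sqrt (2 * Real.log N) with hu
  have hu0 : 0 ≤ u := Real.sqrt_nonneg _
  set l := u + 1 with hl
  have hl0 : 0 < l := by linarith
  set κ := Real.exp (l ^ 2 / 2 - l * u - 1) / l with hκ
  have hκ0 : 0 ≤ κ := by positivity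
  have hNκ : N * κ ≤ 1 := kappa N hN
  let D : Ω → ENNReal := fun ω => ∑ k, ENNReal.ofReal (Real.exp (l * X k ω - l ^ 2 / 2) * κ)
  have hD : ∫⁻ ω, D ω ∂μ ≤ 1 := by
    simp only [D]
    rw [lintegral_finsetSum _ (fun k _ => by have := hXm k; fun_prop)]
    have h1 : ∀ k, ∫⁻ ω, ENNReal.ofReal (Real.exp (l * X k ω - l ^ 2 / 2) * κ) ∂μ =
        ENNReal.ofReal κ := by
      intro k
      have := hCM k (-l) (fun _ => 1) measurable_const
      simp only [lintegral_const, measure_univ, mul_one, one_mul, neg_neg, neg_sq] at this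
      simp_rw [ENNReal.ofReal_mul (Real.exp_nonneg _)]
      rw [lintegral_mul_const _ (by have := hXm k; fun_prop), ← this, one_mul]
    simp_rw [h1]
    rw [Finset.sum_const, Finset.card_univ, Fintype.card_fin, nsmul_eq_mul,
      ← ENNReal.ofReal_natCast, ← ENNReal.ofReal_mul (by positivity)]
    exact ENNReal.ofReal_le_one.2 hNκ
  have hms : ∀ r : ℝ, MeasurableSet {w : Fin N → ℝ | ∃ k, r < w k} := by
    intro r
    have : {w : Fin N → ℝ | ∃ k, r < w k} = ⋃ k, {w | r < w k} := by ext; simp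
    rw [this]
    exact MeasurableSet.iUnion fun k => measurableSet_lt (by fun_prop) (by fun_prop)
  have hind : ∀ r : ℝ, ∫⁻ ω, {w : Fin N → ℝ | ∃ k, r < w k}.indicator (fun _ => (1 : ENNReal)) (W ω) ∂μ
      = μ {ω | ∃ k, r < W ω k} := by
    intro r
    have : ∀ ω, {w : Fin N → ℝ | ∃ k, r < w k}.indicator (fun _ => (1 : ENNReal)) (W ω) =
      {ω | ∃ k, r < W ω k}.indicator (fun _ => (1 : ENNReal)) ω := fun ω => rfl
    simp_rw [this]
    rw [lintegral_indicator_const (s := {ω | ∃ k, r < W ω k}) (hW (hms r)), one_mul]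
  let G : Fin N → (Fin N → ℝ) → ENNReal := fun j => (regA t j).indicator (fun _ => (1 : ENNReal))
  have hGm : ∀ j, Measurable (G j) := fun j => measurable_const.indicator (regA_meas t j)
  have hpt : ∀ ω, {w : Fin N → ℝ | ∃ k, t < w k}.indicator (fun _ => (1 : ENNReal)) (W ω) ≤
      ∑ j, G j (W ω) * ENNReal.ofReal (Real.exp (-ε * X j ω - ε ^ 2 / 2)) +
        (ENNReal.ofReal (ε * u + ε ^ 2 / 2) + ENNReal.ofReal ε * D ω) := by
    intro ω
    by_cases h : ∃ k, t < W ω k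
    · rw [Set.indicator_of_mem (by exact h)]
      obtain ⟨j, hj⟩ := regA_exists t (W ω) h
      have b1 : ENNReal.ofReal (Real.exp (-ε * X j ω - ε ^ 2 / 2)) ≤
          ∑ j, G j (W ω) * ENNReal.ofReal (Real.exp (-ε * X j ω - ε ^ 2 / 2)) := by
        have := Finset.single_le_sum (f := fun j => G j (W ω) *
          ENNReal.ofReal (Real.exp (-ε * X j ω - ε ^ 2 / 2))) (fun _ _ => zero_le)
          (Finset.mem_univ j)
        simpa [G, Set.indicator_of_mem hj] using this
      have b2 : ENNReal.ofReal (Real.exp (l * X j ω - l ^ 2 / 2) * κ) ≤ D ω :=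
        Finset.single_le_sum (f := fun k =>
          ENNReal.ofReal (Real.exp (l * X k ω - l ^ 2 / 2) * κ)) (fun _ _ => zero_le)
          (Finset.mem_univ j)
      refine le_trans ?_ (add_le_add b1 (add_le_add le_rfl (mul_le_mul_right b2 _)))
      rw [← ENNReal.ofReal_mul hε.le, ← ENNReal.ofReal_add (by positivity) (by positivity),
        ← ENNReal.ofReal_add (by positivity) (by positivity), ENNReal.one_le_ofReal]
      have e1 := Real.add_one_le_exp (-ε * X j ω - ε ^ 2 / 2)
      have e2 : X j ω - u ≤ Real.exp (l * X j ω - l ^ 2 / 2) * κ := by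
        rw [hκ, ← mul_div_assoc, ← Real.exp_add, le_div_iff₀ hl0]
        have := Real.add_one_le_exp (l * X j ω - l ^ 2 / 2 + (l ^ 2 / 2 - l * u - 1))
        linarith
      have e3 := mul_le_mul_of_nonneg_left e2 hε.le
      linarith
    · rw [Set.indicator_of_notMem (by exact h)]
      exact zero_le
  have hDm : Measurable D := by
    simp only [D]
    exact Finset.measurable_sum _ fun k _ => by have := hXm k; fun_prop
  have hGX : ∀ j, Measurable fun ω =>
      G j (W ω) * ENNReal.ofReal (Real.exp (-ε * X j ω - ε ^ 2 / 2)) := fun j => by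
    have h1 := hXm j
    exact ((hGm j).comp hW).mul (by fun_prop)
  rw [← hind t, ← hind (t + ε * σ)]
  refine (lintegral_mono hpt).trans ?_
  rw [lintegral_add_right _ (by fun_prop), lintegral_add_left measurable_const,
    lintegral_const_mul _ hDm]
  refine add_le_add ?_ ?_
  · rw [lintegral_finsetSum _ (fun j _ => hGX j)]
    have h1 : ∀ j, ∫⁻ ω, G j (W ω) * ENNReal.ofReal (Real.exp (-ε * X j ω - ε ^ 2 / 2)) ∂μ =
        ∫⁻ ω, G j (fun k => W ω k - ε * c j k) ∂μ := fun j => (hCM j ε (G j) (hGm j)).symm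
    simp_rw [h1]
    rw [← lintegral_finsetSum (f := fun j ω => G j (fun k => W ω k - ε * c j k)) _
      (fun j _ => (hGm j).comp (measurable_pi_iff.2 fun k =>
      (hWk k).sub_const _))]
    exact lintegral_mono fun ω => regA_sum t ε σ hε s c hsσ hcs hc1 hc2 (W ω)
  · calc _ ≤ ENNReal.ofReal (ε * u + ε ^ 2 / 2) + ENNReal.ofReal ε * 1 := by
          rw [lintegral_const, measure_univ, mul_one]
          gcongr
      _ = _ := by
          rw [mul_one, ← ENNReal.ofReal_add (by positivity) (by positivity)]
          congr 1; rw [hl]; ring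

/-- Nazarov's inequality: for a (not necessarily centered) Gaussian random vector
`W = (W₁,…,W_N)` with `min_j Var(W_j) ≥ σ̲² > 0` and `W^∨ = max_j W_j`,
`P(t < W^∨ ≤ t + δ) ≤ (δ/σ̲)(√(2 log N) + 2)` for all `t ∈ ℝ`, `δ > 0`. -/
theorem stmt19 {Ω : Type*} [MeasurableSpace Ω] (μ : Measure Ω) [IsProbabilityMeasure μ]
    (N : ℕ) (hN : 0 < N) (W : Ω → Fin N → ℝ)
    (hmeas : ∀ j, Measurable fun ω => W ω j)
    (hgauss : ∀ a : Fin N → ℝ, ∃ (m : ℝ) (v : NNReal),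
      Measure.map (fun ω => ∑ j, a j * W ω j) μ = gaussianReal m v)
    (σmin : ℝ) (hσmin : 0 < σmin)
    (hvar : ∀ j, σmin ^ 2 ≤ variance (fun ω => W ω j) μ)
    (t δ : ℝ) (hδ : 0 < δ) :
    μ {ω | t < Finset.univ.sup' (Finset.univ_nonempty_iff.mpr
          (Fin.pos_iff_nonempty.mp hN)) (fun j => W ω j) ∧
        Finset.univ.sup' (Finset.univ_nonempty_iff.mpr
          (Fin.pos_iff_nonempty.mp hN)) (fun j => W ω j) ≤ t + δ} ≤
      ENNReal.ofReal (δ / σmin * (Real.sqrt (2 * Real.log N) + 2)) := by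
  have hW : Measurable W := measurable_pi_iff.2 hmeas
  have hG := gaussLaw μ N W hmeas hgauss
  have hiter : ∀ (ε : ℝ), 0 < ε → ∀ n : ℕ,
      μ {ω | ∃ k, t < W ω k} ≤ μ {ω | ∃ k, t + n * (ε * σmin) < W ω k} +
      n * ENNReal.ofReal (ε * (Real.sqrt (2 * Real.log N) + 1) + ε ^ 2 / 2) := by
    intro ε hε n
    induction n with
    | zero => simp
    | succ n ih =>
      refine ih.trans ?_
      refine (add_le_add (step μ hN W hW hG σmin hσmin hvar ε hε _) le_rfl).trans ?_
      have e : t + ((n + 1 : ℕ) : ℝ) * (ε * σmin) = t + n * (ε * σmin) + ε * σmin := by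
        push_cast; ring
      rw [e]
      push_cast
      rw [add_assoc, add_mul, one_mul, add_comm (ENNReal.ofReal _)]
  obtain ⟨n, hn⟩ := exists_nat_gt (δ / σmin)
  have hq : 0 < δ / σmin := by positivity
  have hn0 : (0 : ℝ) < n := hq.trans hn
  have hε : 0 < δ / σmin / n := by positivity
  have h := hiter (δ / σmin / n) hε n
  have e1 : t + n * (δ / σmin / n * σmin) = t + δ := by field_simp
  rw [e1] at h
  have hset : {ω | t < Finset.univ.sup' (Finset.univ_nonempty_iff.mpr
          (Fin.pos_iff_nonempty.mp hN)) (fun j => W ω j) ∧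
        Finset.univ.sup' (Finset.univ_nonempty_iff.mpr
          (Fin.pos_iff_nonempty.mp hN)) (fun j => W ω j) ≤ t + δ} =
      {ω | ∃ k, t < W ω k} \ {ω | ∃ k, t + δ < W ω k} := by
    ext ω
    simp [Finset.lt_sup'_iff, Finset.sup'_le_iff]
  have hms : MeasurableSet {ω | ∃ k, t + δ < W ω k} := by
    have : {ω | ∃ k, t + δ < W ω k} = ⋃ k, {ω | t + δ < W ω k} := by ext; simp
    rw [this]
    exact MeasurableSet.iUnion fun k => measurableSet_lt measurable_const (hmeas k)
  rw [hset, measure_sdiff _ hms.nullMeasurableSet (measure_ne_top _ _)]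
  · rw [tsub_le_iff_left]
    refine h.trans (add_le_add le_rfl ?_)
    rw [← ENNReal.ofReal_natCast, ← ENNReal.ofReal_mul hn0.le]
    apply ENNReal.ofReal_le_ofReal
    have h2 : δ / σmin / n ≤ 1 := (div_le_one hn0).2 hn.le
    have h3 : (n : ℝ) * (δ / σmin / n) = δ / σmin := by field_simp
    have hu0 := Real.sqrt_nonneg (2 * Real.log N)
    generalize Real.sqrt (2 * Real.log N) = u at *
    generalize δ / σmin = q at *
    generalize q / n = e at *
    rw [← h3]
    nlinarith [mul_pos hn0 hε, mul_le_mul_of_nonneg_left h2 (mul_pos hn0 hε).le]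
  · rintro ω ⟨k, hk⟩
    exact ⟨k, by linarith⟩
end
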